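/- The measure algebra M₀(ℝ) contains a family {μ_α}_{α∈ℝ} of continuum many Hermitian probability measures with independent powers such that μ_α ∗ μ_β ∈ L¹(ℝ) for all α ≠ β. -/

import Mathlib

/-!
`M₀(ℝ)` contains continuum many Hermitian probability measures with independent powers
whose pairwise convolutions are absolutely continuous (`∈ L¹(ℝ)`).
Here the dual group of `ℝ` is identified with `ℝ` via `t ↦ (x ↦ e^{-itx})`, so the
Fourier–Stieltjes transform is `μ̂(t) = ∫ e^{-itx} dμ(x)`.
-/

open MeasureTheory Filter Topology

noncomputable section

/-- The Fourier–Stieltjes transform of a measure on `ℝ`: `μ̂(t) = ∫ e^{-itx} dμ(x)`. -/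
def FSR (μ : Measure ℝ) (t : ℝ) : ℂ :=
  ∫ x, Complex.exp (-(t * x) * Complex.I) ∂μ

/-- Convolution powers of a measure on `ℝ`:
`convPowR μ 0 = δ₀`, `convPowR μ (n+1) = μ ∗ convPowR μ n`. -/
def convPowR (μ : Measure ℝ) : ℕ → Measure ℝ
  | 0 => Measure.dirac 0
  | n + 1 => μ.conv (convPowR μ n)

/-- `μ` has independent powers: all distinct convolution powers of `μ` are mutually
singular. -/
def HasIndependentPowersR (μ : Measure ℝ) : Prop :=
  ∀ m n : ℕ, 0 < m → 0 < n → m ≠ n → (convPowR μ m).MutuallySingular (convPowR μ n)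

/-- The values `0, 1, -1` of a balanced ternary digit. -/
def digitValue : Fin 3 → ℝ := ![0, 1, -1]

/-- The law of a balanced ternary digit which vanishes with probability `e` and is uniform
otherwise. -/
def digitLaw (e : unitInterval) : Measure (Fin 3) :=
  ENNReal.ofReal ((1 + 2 * e) / 3) • Measure.dirac 0 +
    ENNReal.ofReal ((1 - e) / 3) • Measure.dirac 1 + ENNReal.ofReal ((1 - e) / 3) • Measure.dirac 2

/-- The characteristic function of `digitLaw`. -/
def digitChar (e θ : ℝ) : ℝ := e + (1 - e) * ((1 + 2 * Real.cos θ) / 3)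

instance (e : unitInterval) : IsProbabilityMeasure (digitLaw e) := by
  constructor
  have h0 := e.2.1
  have h1 := e.2.2
  simp only [digitLaw, Measure.add_apply, Measure.smul_apply, measure_univ, smul_eq_mul, mul_one]
  rw [← ENNReal.ofReal_add (by linarith) (by linarith),
    ← ENNReal.ofReal_add (by linarith) (by linarith), ← ENNReal.ofReal_one]
  congr 1
  ring

lemma integral_digitLaw (e : unitInterval) (f : Fin 3 → ℂ) :
    ∫ x, f x ∂(digitLaw e) =
      ((1 + 2 * e) / 3 : ℝ) * f 0 + ((1 - e) / 3 : ℝ) * f 1 + ((1 - e) / 3 : ℝ) * f 2 := by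
  have h0 := e.2.1
  have h1 := e.2.2
  have h (c : ℝ) (a : Fin 3) : Integrable f (ENNReal.ofReal c • Measure.dirac a) :=
    (integrable_dirac (by simp)).smul_measure (by simp)
  rw [digitLaw, integral_add_measure ((h _ _).add_measure (h _ _)) (h _ _),
    integral_add_measure (h _ _) (h _ _)]
  simp only [integral_smul_measure, integral_dirac]
  rw [ENNReal.toReal_ofReal (by linarith), ENNReal.toReal_ofReal (by linarith)]
  simp

lemma charFun_digitLaw_map (e : unitInterval) (c t : ℝ) :
    charFun ((digitLaw e).map (fun x ↦ digitValue x * c)) t = (digitChar e (t * c) : ℂ) := by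
  rw [charFun_apply_real, integral_map (by fun_prop) (by fun_prop), integral_digitLaw]
  simp only [digitValue, Matrix.cons_val_zero, Matrix.cons_val_one, Matrix.cons_val]
  have h := Complex.two_cos (t * c)
  rw [digitChar]
  push_cast
  rw [h]
  simp
  ring_nf

lemma abs_digitChar_le_one (e : unitInterval) (θ : ℝ) : |digitChar e θ| ≤ 1 := by
  have h0 := e.2.1
  have h1 := e.2.2
  have h2 := Real.neg_one_le_cos θ
  have h3 := Real.cos_le_one θ
  rw [abs_le, digitChar]
  constructor <;> nlinarith

/-- The law of `∑ ωᵢ / 3 ^ (i + 1)`, where the `ωᵢ` are independent balanced ternary digits with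
laws `digitLaw (e i)`. -/
def ternaryLaw (e : ℕ → unitInterval) : Measure ℝ :=
  (Measure.infinitePi (fun i ↦ digitLaw (e i))).map
    (fun ω ↦ ∑' i, digitValue (ω i) * (1 / 3) ^ (i + 1))

lemma summable_digits (ω : ℕ → Fin 3) :
    Summable (fun i ↦ digitValue (ω i) * (1 / 3 : ℝ) ^ (i + 1)) := by
  refine Summable.of_norm_bounded (g := fun i ↦ (1 / 3 : ℝ) ^ (i + 1)) ?_ fun i ↦ ?_
  · exact (summable_nat_add_iff 1).2 (summable_geometric_of_lt_one (by norm_num) (by norm_num))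
  · have : |digitValue (ω i)| ≤ 1 := by
      generalize ω i = a
      fin_cases a <;> simp [digitValue]
    rw [norm_mul, norm_pow, Real.norm_eq_abs, Real.norm_eq_abs,
      abs_of_pos (by norm_num : (0 : ℝ) < 1 / 3)]
    exact mul_le_of_le_one_left (by positivity) this

lemma measurable_digits :
    Measurable (fun ω : ℕ → Fin 3 ↦ ∑' i, digitValue (ω i) * (1 / 3 : ℝ) ^ (i + 1)) := by
  have h (i : ℕ) : Measurable (fun ω : ℕ → Fin 3 ↦ digitValue (ω i) * (1 / 3 : ℝ) ^ (i + 1)) :=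
    ((Measurable.of_discrete (f := digitValue)).comp (measurable_pi_apply i)).mul_const _
  exact measurable_of_tendsto_metrizable (fun N ↦ Finset.measurable_sum _ fun i _ ↦ h i)
    (tendsto_pi_nhds.2 fun ω ↦ by
      simpa using (summable_digits ω).hasSum.tendsto_sum_nat)

instance (e : ℕ → unitInterval) : IsProbabilityMeasure (ternaryLaw e) :=
  Measure.isProbabilityMeasure_map measurable_digits.aemeasurable

lemma tendsto_charFun_ternaryLaw (e : ℕ → unitInterval) (t : ℝ) :
    Tendsto (fun N ↦ ((∏ i ∈ Finset.range N, digitChar (e i) (t * (1 / 3) ^ (i + 1)) : ℝ) : ℂ))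
      atTop (𝓝 (charFun (ternaryLaw e) t)) := by
  set P := Measure.infinitePi (fun i ↦ digitLaw (e i)) with hP
  have hm (i : ℕ) : Measurable (fun a : Fin 3 ↦ digitValue a * (1 / 3 : ℝ) ^ (i + 1)) :=
    Measurable.of_discrete
  have hX (i : ℕ) : Measurable (fun ω : ℕ → Fin 3 ↦ digitValue (ω i) * (1 / 3 : ℝ) ^ (i + 1)) :=
    (hm i).comp (measurable_pi_apply i)
  have hind := ProbabilityTheory.iIndepFun_infinitePi (P := fun i ↦ digitLaw (e i))
    (X := fun i a ↦ digitValue a * (1 / 3 : ℝ) ^ (i + 1)) hm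
  have hfin (N : ℕ) :
      charFun (P.map (fun ω ↦ ∑ i ∈ Finset.range N, digitValue (ω i) * (1 / 3 : ℝ) ^ (i + 1))) t =
        ((∏ i ∈ Finset.range N, digitChar (e i) (t * (1 / 3) ^ (i + 1)) : ℝ) : ℂ) := by
    have hind' : ProbabilityTheory.iIndepFun (fun (i : Finset.range N) (ω : ℕ → Fin 3) ↦
        digitValue (ω i) * (1 / 3 : ℝ) ^ ((i : ℕ) + 1)) P :=
      hind.precomp Subtype.val_injective
    rw [ProbabilityTheory.iIndepFun.charFun_map_fun_finsetSum_eq_prod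
      (fun i _ ↦ (hX i).aemeasurable) hind', Finset.prod_apply]
    push_cast
    refine Finset.prod_congr rfl fun i _ ↦ ?_
    rw [← charFun_digitLaw_map (e i), ← Measure.infinitePi_map_eval (fun i ↦ digitLaw (e i)) i,
      Measure.map_map (hm i) (measurable_pi_apply i)]
    rfl
  simp_rw [← hfin, ternaryLaw, charFun_apply_real]
  rw [integral_map measurable_digits.aemeasurable (by fun_prop)]
  simp_rw [integral_map (Finset.measurable_sum _ fun i _ ↦ hX i).aemeasurable
    (by fun_prop : AEStronglyMeasurable (fun x : ℝ ↦ Complex.exp (t * x * Complex.I)) _)]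
  refine tendsto_integral_of_dominated_convergence (fun _ ↦ 1) (fun N ↦ ?_) (by simp)
    (fun N ↦ ?_) ?_
  · exact ((by fun_prop : Continuous (fun x : ℝ ↦ Complex.exp (t * x * Complex.I))).measurable.comp
      (Finset.measurable_sum (Finset.range N) fun i _ ↦ hX i)).aestronglyMeasurable
  · refine ae_of_all _ fun ω ↦ ?_
    rw [← Complex.ofReal_mul, Complex.norm_exp_ofReal_mul_I]
  · refine ae_of_all _ fun ω ↦ ?_
    have := (summable_digits ω).hasSum.tendsto_sum_nat
    exact ((by fun_prop :
      Continuous (fun x : ℝ ↦ Complex.exp (t * x * Complex.I))).tendsto _).comp this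

/-- The (real-valued) characteristic function of `ternaryLaw`. -/
def ternaryChar (e : ℕ → unitInterval) (t : ℝ) : ℝ := (charFun (ternaryLaw e) t).re

lemma tendsto_ternaryChar (e : ℕ → unitInterval) (t : ℝ) :
    Tendsto (fun N ↦ ∏ i ∈ Finset.range N, digitChar (e i) (t * (1 / 3) ^ (i + 1))) atTop
      (𝓝 (ternaryChar e t)) :=
  (Complex.continuous_re.tendsto _).comp (tendsto_charFun_ternaryLaw e t)

lemma charFun_ternaryLaw (e : ℕ → unitInterval) (t : ℝ) :
    charFun (ternaryLaw e) t = (ternaryChar e t : ℂ) :=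
  tendsto_nhds_unique (tendsto_charFun_ternaryLaw e t)
    ((Complex.continuous_ofReal.tendsto _).comp (tendsto_ternaryChar e t))

lemma abs_ternaryChar_le_one (e : ℕ → unitInterval) (t : ℝ) : |ternaryChar e t| ≤ 1 :=
  (Complex.abs_re_le_norm _).trans (norm_charFun_le_one t)

lemma ternaryChar_zero (e : ℕ → unitInterval) : ternaryChar e 0 = 1 := by
  simp [ternaryChar]

lemma ternaryChar_neg (e : ℕ → unitInterval) (t : ℝ) : ternaryChar e (-t) = ternaryChar e t := by
  simp [ternaryChar, charFun_neg]

lemma ternaryChar_eq_prod_mul (e : ℕ → unitInterval) (n : ℕ) (t : ℝ) :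
    ternaryChar e t = (∏ i ∈ Finset.range n, digitChar (e i) (t * (1 / 3) ^ (i + 1))) *
      ternaryChar (fun i ↦ e (n + i)) (t * (1 / 3) ^ n) := by
  refine tendsto_nhds_unique ((tendsto_add_atTop_iff_nat n).2 (tendsto_ternaryChar e t)) ?_
  convert (tendsto_ternaryChar (fun i ↦ e (n + i)) (t * (1 / 3) ^ n)).const_mul _ using 2 with N
  rw [add_comm N n, Finset.prod_range_add]
  congr 1
  refine Finset.prod_congr rfl fun i _ ↦ ?_
  ring_nf

lemma abs_prod_sub_prod_le {ι : Type*} (s : Finset ι) (f g : ι → ℝ) (hf : ∀ i, |f i| ≤ 1)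
    (hg : ∀ i, |g i| ≤ 1) : |∏ i ∈ s, f i - ∏ i ∈ s, g i| ≤ ∑ i ∈ s, |f i - g i| := by
  classical
  induction s using Finset.induction_on with
  | empty => simp
  | insert a s ha ih =>
    rw [Finset.prod_insert ha, Finset.prod_insert ha, Finset.sum_insert ha]
    have h1 : |∏ i ∈ s, g i| ≤ 1 := by
      rw [Finset.abs_prod]
      exact Finset.prod_le_one (fun _ _ ↦ abs_nonneg _) fun i _ ↦ hg i
    calc |f a * ∏ i ∈ s, f i - g a * ∏ i ∈ s, g i|
        = |f a * (∏ i ∈ s, f i - ∏ i ∈ s, g i) + (f a - g a) * ∏ i ∈ s, g i| := by ring_nf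
      _ ≤ |f a| * |∏ i ∈ s, f i - ∏ i ∈ s, g i| + |f a - g a| * |∏ i ∈ s, g i| := by
          rw [← abs_mul, ← abs_mul]
          exact abs_add_le _ _
      _ ≤ 1 * |∏ i ∈ s, f i - ∏ i ∈ s, g i| + |f a - g a| * 1 := by
          gcongr
          exact hf a
      _ ≤ _ := by linarith

lemma abs_ternaryChar_sub_le (e e' : ℕ → unitInterval) (s t C : ℝ)
    (h : ∀ i, |digitChar (e i) (s * (1 / 3) ^ (i + 1)) - digitChar (e' i) (t * (1 / 3) ^ (i + 1))| ≤
      2 * C * (1 / 3) ^ (i + 1)) : |ternaryChar e s - ternaryChar e' t| ≤ C := by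
  refine le_of_tendsto ((tendsto_ternaryChar e s).sub (tendsto_ternaryChar e' t)).abs
    (Eventually.of_forall fun N ↦ ?_)
  refine (abs_prod_sub_prod_le _ _ _ (fun i ↦ abs_digitChar_le_one _ _)
    (fun i ↦ abs_digitChar_le_one _ _)).trans ((Finset.sum_le_sum fun i _ ↦ h i).trans ?_)
  have hC : 0 ≤ C := by
    have := (abs_nonneg _).trans (h 0)
    linarith
  simp_rw [pow_succ]
  rw [← Finset.mul_sum, ← Finset.sum_mul, geom_sum_eq (by norm_num)]
  have : (0 : ℝ) ≤ (1 / 3) ^ N := by positivity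
  calc 2 * C * (((1 / 3) ^ N - 1) / (1 / 3 - 1) * (1 / 3)) = C * (1 - (1 / 3) ^ N) := by ring
    _ ≤ C := mul_le_of_le_one_right hC (by linarith)

lemma abs_ternaryChar_sub_le_abs_sub (e : ℕ → unitInterval) (s t : ℝ) :
    |ternaryChar e s - ternaryChar e t| ≤ |s - t| := by
  refine abs_ternaryChar_sub_le _ _ _ _ _ fun i ↦ ?_
  have h0 := (e i).2.1
  have h1 := (e i).2.2
  have h2 := Real.abs_cos_sub_cos_le (s * (1 / 3) ^ (i + 1)) (t * (1 / 3) ^ (i + 1))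
  rw [← sub_mul, abs_mul, abs_of_pos (by positivity : (0 : ℝ) < (1 / 3) ^ (i + 1))] at h2
  have : digitChar (e i) (s * (1 / 3) ^ (i + 1)) - digitChar (e i) (t * (1 / 3) ^ (i + 1)) =
      (1 - e i) * (2 / 3) *
        (Real.cos (s * (1 / 3) ^ (i + 1)) - Real.cos (t * (1 / 3) ^ (i + 1))) := by
    simp only [digitChar]
    ring
  rw [this, abs_mul, abs_of_nonneg (by linarith)]
  have h3 := abs_nonneg (Real.cos (s * (1 / 3) ^ (i + 1)) - Real.cos (t * (1 / 3) ^ (i + 1)))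
  nlinarith [mul_nonneg h0 h3]

lemma ternaryChar_const_zero (t : ℝ) : ternaryChar (fun _ ↦ 0) t = Real.sinc (t / 2) := by
  have key (x : ℝ) : Real.sinc (3 * x) = digitChar 0 (2 * x) * Real.sinc x := by
    rcases eq_or_ne x 0 with rfl | hx
    · simp [digitChar]
      norm_num
    · rw [Real.sinc_of_ne_zero (by positivity), Real.sinc_of_ne_zero hx, digitChar,
        Real.cos_two_mul, Real.sin_three_mul]
      field_simp
      linear_combination (-4 * Real.sin x) * (Real.sin_sq_add_cos_sq x)
  have fin (N : ℕ) : Real.sinc (t / 2) =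
      (∏ i ∈ Finset.range N, digitChar 0 (t * (1 / 3) ^ (i + 1))) *
        Real.sinc (t / 2 * (1 / 3) ^ N) := by
    induction N with
    | zero => simp
    | succ N ih =>
      rw [Finset.prod_range_succ, ih, mul_assoc]
      have := key (t / 2 * (1 / 3) ^ (N + 1))
      rw [show 3 * (t / 2 * (1 / 3) ^ (N + 1)) = t / 2 * (1 / 3) ^ N by ring,
        show 2 * (t / 2 * (1 / 3) ^ (N + 1)) = t * (1 / 3) ^ (N + 1) by ring] at this
      rw [this]
  have h1 : Tendsto (fun N : ℕ ↦ t / 2 * (1 / 3 : ℝ) ^ N) atTop (𝓝 0) := by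
    simpa using (tendsto_pow_atTop_nhds_zero_of_lt_one (r := (1 / 3 : ℝ)) (by norm_num)
      (by norm_num)).const_mul (t / 2)
  have h2 := (Real.continuous_sinc.tendsto 0).comp h1
  have h3 := (tendsto_ternaryChar (fun _ ↦ 0) t).mul h2
  rw [Real.sinc_zero, mul_one] at h3
  refine tendsto_nhds_unique (h3.congr fun N ↦ ?_) tendsto_const_nhds
  rw [fin N]
  simp

lemma ternaryLaw_const_zero_absolutelyContinuous : ternaryLaw (fun _ ↦ 0) ≪ volume := by
  suffices h : ternaryLaw (fun _ ↦ 0) = volume.restrict (Set.Ioc (-(1 / 2)) (1 / 2)) by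
    rw [h]
    exact Measure.absolutelyContinuous_of_le Measure.restrict_le_self
  refine Measure.ext_of_charFun (funext fun t ↦ ?_)
  rw [charFun_ternaryLaw, ternaryChar_const_zero, charFun_apply_real,
    ← intervalIntegral.integral_of_le (by norm_num)]
  rcases eq_or_ne t 0 with rfl | ht
  · simp
    norm_num
  · have hc : (t * Complex.I : ℂ) ≠ 0 := by simp [ht]
    have : ∀ x : ℝ, Complex.exp (t * x * Complex.I) = Complex.exp ((t * Complex.I) * x) := by
      intro x; ring_nf
    simp_rw [this]
    rw [integral_exp_mul_complex hc, Real.sinc_of_ne_zero (by positivity)]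
    have htC : (t : ℂ) ≠ 0 := by exact_mod_cast ht
    push_cast
    rw [Complex.sin]
    have hI := Complex.I_sq
    field_simp
    ring_nf
    simp [Complex.I_sq]

lemma abs_sinc_half_le (s : ℝ) (hs : s ≠ 0) : |Real.sinc (s / 2)| ≤ 2 / |s| := by
  rw [Real.sinc_of_ne_zero (by positivity), abs_div, abs_div, abs_two, div_div_eq_mul_div]
  gcongr
  linarith [Real.abs_sin_le_one (s / 2)]

lemma abs_ternaryChar_sub_sinc_le (e : ℕ → unitInterval) (η s : ℝ) (h : ∀ i, (e i : ℝ) ≤ η) :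
    |ternaryChar e s - Real.sinc (s / 2)| ≤ η * |s| := by
  rw [← ternaryChar_const_zero]
  refine abs_ternaryChar_sub_le _ _ _ _ _ fun i ↦ ?_
  have h0 := (e i).2.1
  have h2 := Real.abs_cos_sub_cos_le 0 (s * (1 / 3) ^ (i + 1))
  rw [Real.cos_zero, zero_sub, abs_neg, abs_mul,
    abs_of_pos (by positivity : (0 : ℝ) < (1 / 3) ^ (i + 1))] at h2
  have : digitChar (e i) (s * (1 / 3) ^ (i + 1)) -
      digitChar (0 : unitInterval) (s * (1 / 3) ^ (i + 1)) =
      e i * (2 / 3) * (1 - Real.cos (s * (1 / 3) ^ (i + 1))) := by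
    simp only [digitChar, Set.Icc.coe_zero]
    ring
  rw [this, abs_mul, abs_of_nonneg (by positivity)]
  have hη : 0 ≤ η := h0.trans (h i)
  calc _ ≤ η * (2 / 3) * (|s| * (1 / 3) ^ (i + 1)) := by
        gcongr
        exact h i
    _ ≤ _ := by
        have : 0 ≤ η * |s| * (1 / 3 : ℝ) ^ (i + 1) := by positivity
        linarith

lemma abs_prod_digitChar_le_one (e : ℕ → unitInterval) (t : ℝ) (n : ℕ) :
    |∏ i ∈ Finset.range n, digitChar (e i) (t * (1 / 3) ^ (i + 1))| ≤ 1 := by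
  rw [Finset.abs_prod]
  exact Finset.prod_le_one (fun _ _ ↦ abs_nonneg _) fun i _ ↦ abs_digitChar_le_one _ _

lemma tendsto_ternaryChar_cocompact (e : ℕ → unitInterval)
    (he : Tendsto (fun k ↦ (e k : ℝ)) atTop (𝓝 0)) :
    Tendsto (ternaryChar e) (cocompact ℝ) (𝓝 0) := by
  rw [Metric.tendsto_nhds]
  intro δ hδ
  set M := 8 / δ with hM
  have hMpos : 0 < M := by positivity
  set η := δ / (12 * M) with hη
  have hηpos : 0 < η := by positivity
  obtain ⟨N, hN⟩ := eventually_atTop.1 (he.eventually (ge_mem_nhds hηpos))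
  filter_upwards [(tendsto_norm_cocompact_atTop (E := ℝ)).eventually_ge_atTop (M * 3 ^ N)] with t ht
  rw [Real.norm_eq_abs] at ht
  have h1 : 1 ≤ |t| / M := by
    rw [le_div_iff₀ hMpos, one_mul]
    exact le_trans (le_mul_of_one_le_right hMpos.le (one_le_pow₀ (by norm_num))) ht
  obtain ⟨n, hn, hn'⟩ := exists_nat_pow_near h1 (by norm_num : (1 : ℝ) < 3)
  rw [le_div_iff₀ hMpos] at hn
  rw [div_lt_iff₀ hMpos] at hn'
  have hNn : N ≤ n := by
    have : (3 : ℝ) ^ N < 3 ^ (n + 1) := by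
      have := ht.trans_lt hn'
      rw [mul_comm] at this
      exact lt_of_mul_lt_mul_right this hMpos.le
    have := (pow_lt_pow_iff_right₀ (by norm_num : (1 : ℝ) < 3)).1 this
    omega
  set s := t * (1 / 3) ^ n with hs
  have hsabs : |s| = |t| / 3 ^ n := by
    rw [hs, abs_mul, abs_of_pos (by positivity : (0 : ℝ) < (1 / 3) ^ n), one_div, inv_pow]
    rfl
  have hs1 : M ≤ |s| := by
    rw [hsabs, le_div_iff₀ (by positivity)]
    linarith
  have hs2 : |s| ≤ 3 * M := by
    rw [hsabs, div_le_iff₀ (by positivity)]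
    rw [pow_succ] at hn'
    linarith
  have hs0 : s ≠ 0 := abs_pos.1 (hMpos.trans_le hs1)
  have h2 := abs_ternaryChar_sub_sinc_le (fun i ↦ e (n + i)) η s fun i ↦ hN _ (by omega)
  have h3 := abs_sinc_half_le s hs0
  have h4 : 2 / |s| ≤ δ / 4 := by
    calc 2 / |s| ≤ 2 / M := by gcongr
      _ = δ / 4 := by rw [hM]; field_simp; norm_num
  have h5 : η * |s| ≤ δ / 4 := by
    calc η * |s| ≤ η * (3 * M) := by gcongr
      _ = δ / 4 := by rw [hη]; field_simp; norm_num
  rw [dist_zero_right, Real.norm_eq_abs, ternaryChar_eq_prod_mul e n, abs_mul, ← hs]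
  have h6 : |ternaryChar (fun i ↦ e (n + i)) s| ≤ δ / 2 := by
    have := abs_sub_abs_le_abs_sub (ternaryChar (fun i ↦ e (n + i)) s) (Real.sinc (s / 2))
    linarith
  calc _ ≤ 1 * (δ / 2) := by
        gcongr
        exact abs_prod_digitChar_le_one e t n
    _ < δ := by linarith

lemma ternaryChar_const_one (t : ℝ) : ternaryChar (fun _ ↦ 1) t = 1 :=
  tendsto_nhds_unique (tendsto_ternaryChar _ t) (by simp [digitChar])

lemma ternaryChar_mul_of_disjoint (e e' : ℕ → unitInterval) (h : ∀ i, e i = 0 ∨ e' i = 0) (t : ℝ) :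
    ternaryChar e t * ternaryChar e' t =
      ternaryChar (fun i ↦ max (e i) (e' i)) t * ternaryChar (fun _ ↦ 0) t := by
  refine tendsto_nhds_unique ((tendsto_ternaryChar e t).mul (tendsto_ternaryChar e' t)) ?_
  refine ((tendsto_ternaryChar _ t).mul (tendsto_ternaryChar _ t)).congr fun N ↦ ?_
  rw [← Finset.prod_mul_distrib, ← Finset.prod_mul_distrib]
  refine Finset.prod_congr rfl fun i _ ↦ ?_
  rcases h i with h | h
  · rw [h, max_eq_right unitInterval.nonneg', mul_comm]
  · rw [h, max_eq_left unitInterval.nonneg']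

lemma ternaryChar_truncate (e : ℕ → unitInterval) (n : ℕ) (t : ℝ) :
    ternaryChar (fun i ↦ if i < n then e i else 1) t =
      ∏ i ∈ Finset.range n, digitChar (e i) (t * (1 / 3) ^ (i + 1)) := by
  rw [ternaryChar_eq_prod_mul _ n]
  simp only [Nat.not_lt_of_le (Nat.le_add_right n _), if_false, ternaryChar_const_one, mul_one]
  exact Finset.prod_congr rfl fun i hi ↦ by rw [if_pos (Finset.mem_range.1 hi)]

lemma ternaryLaw_conv_absolutelyContinuous (e e' : ℕ → unitInterval) (n : ℕ)
    (h : ∀ i, n ≤ i → e i = 0 ∨ e' i = 0) :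
    (ternaryLaw e).conv (ternaryLaw e') ≪ volume := by
  have hmeas : Measurable (fun x : ℝ ↦ (1 / 3 : ℝ) ^ n * x) := by fun_prop
  have hprob (ν : Measure ℝ) [IsProbabilityMeasure ν] :
      IsProbabilityMeasure (ν.map (fun x ↦ (1 / 3 : ℝ) ^ n * x)) :=
    Measure.isProbabilityMeasure_map hmeas.aemeasurable
  have hac : (ternaryLaw (fun _ ↦ 0)).map (fun x ↦ (1 / 3 : ℝ) ^ n * x) ≪ volume := by
    refine (ternaryLaw_const_zero_absolutelyContinuous.map hmeas).trans ?_
    rw [Real.map_volume_mul_left (by positivity)]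
    exact Measure.smul_absolutelyContinuous
  have := Measure.conv_absolutelyContinuous
    (μ := ((ternaryLaw (fun i ↦ if i < n then e i else 1)).conv
    (ternaryLaw (fun i ↦ if i < n then e' i else 1))).conv
    ((ternaryLaw (fun i ↦ max (e (n + i)) (e' (n + i)))).map (fun x ↦ (1 / 3 : ℝ) ^ n * x))) hac
  convert this using 1
  refine Measure.ext_of_charFun (funext fun t ↦ ?_)
  simp only [charFun_conv, charFun_map_mul, charFun_ternaryLaw, ternaryChar_truncate]
  rw [ternaryChar_eq_prod_mul e n, ternaryChar_eq_prod_mul e' n]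
  have := ternaryChar_mul_of_disjoint (fun i ↦ e (n + i)) (fun i ↦ e' (n + i))
    (fun i ↦ h _ (Nat.le_add_right n i)) (t * (1 / 3) ^ n)
  rw [mul_comm ((1 / 3) ^ n) t]
  norm_cast
  rw [mul_mul_mul_comm, this]
  ring

lemma half_le_ternaryChar (e : ℕ → unitInterval) :
    1 / 2 ≤ ternaryChar e (2 * Real.pi * (1 / 3)) := by
  have h := abs_ternaryChar_sub_le e e (2 * Real.pi * (1 / 3)) 0 (1 / 2) fun i ↦ ?_
  · rw [ternaryChar_zero, abs_le] at h
    linarith [h.1]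
  · have h0 := (e i).2.1
    have h1 := (e i).2.2
    set r : ℝ := (1 / 3) ^ (i + 1) with hr
    have hr0 : 0 < r := by positivity
    have hr1 : r ≤ 1 / 3 := by
      rw [hr, pow_succ]
      exact mul_le_of_le_one_left (by norm_num) (pow_le_one₀ (by norm_num) (by norm_num))
    have h2 := Real.one_sub_sq_div_two_le_cos (x := 2 * Real.pi * (1 / 3) * r)
    have h3 := Real.cos_le_one (2 * Real.pi * (1 / 3) * r)
    have h4 : digitChar (e i) (2 * Real.pi * (1 / 3) * r) - digitChar (e i) (0 * r) =
        -((1 - e i) * (2 / 3) * (1 - Real.cos (2 * Real.pi * (1 / 3) * r))) := by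
      simp only [digitChar, zero_mul, Real.cos_zero]
      ring
    rw [h4, abs_neg, abs_of_nonneg (mul_nonneg (by linarith) (by linarith))]
    have h5 : Real.pi ^ 2 ≤ 10 := by nlinarith [Real.pi_lt_d2, Real.pi_pos]
    have h6 : (1 - e i : ℝ) * (2 / 3) * (1 - Real.cos (2 * Real.pi * (1 / 3) * r)) ≤
        1 * (2 / 3) * ((2 * Real.pi * (1 / 3) * r) ^ 2 / 2) := by
      gcongr <;> linarith
    nlinarith [mul_pos hr0 hr0, mul_le_mul_of_nonneg_left hr1 hr0.le]

lemma digitChar_add_two_pi_mul_pow (e θ : ℝ) {i k : ℕ} (h : i < k) :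
    digitChar e ((2 * Real.pi * 3 ^ k + θ) * (1 / 3) ^ (i + 1)) =
      digitChar e (θ * (1 / 3) ^ (i + 1)) := by
  obtain ⟨d, rfl⟩ := Nat.exists_eq_add_of_lt h
  have : (2 * Real.pi * 3 ^ (i + d + 1) + θ) * (1 / 3) ^ (i + 1) =
      θ * (1 / 3) ^ (i + 1) + (3 ^ d : ℕ) * (2 * Real.pi) := by
    rw [show i + d + 1 = (i + 1) + d by ring, pow_add, add_mul]
    have : (3 : ℝ) ^ (i + 1) * (1 / 3) ^ (i + 1) = 1 := by
      rw [← mul_pow]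
      norm_num
    push_cast
    linear_combination (2 * Real.pi * 3 ^ d) * this
  rw [digitChar, digitChar, this, Real.cos_add_nat_mul_two_pi]

lemma ternaryChar_two_pi_mul_pow_add (e : ℕ → unitInterval) (k : ℕ) (b : ℝ) :
    ternaryChar e (2 * Real.pi * 3 ^ k + b) =
      (∏ i ∈ Finset.range k, digitChar (e i) (b * (1 / 3) ^ (i + 1))) *
        ternaryChar (fun i ↦ e (k + i)) (2 * Real.pi + b * (1 / 3) ^ k) := by
  rw [ternaryChar_eq_prod_mul e k]
  congr 1
  · exact Finset.prod_congr rfl fun i hi ↦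
      digitChar_add_two_pi_mul_pow _ _ (Finset.mem_range.1 hi)
  · rw [add_mul, mul_assoc, ← mul_pow]
    norm_num

lemma ternaryChar_two_pi_mul_pow (e : ℕ → unitInterval) (k : ℕ) :
    ternaryChar e (2 * Real.pi * 3 ^ k) =
      e k * ternaryChar (fun i ↦ e (k + (1 + i))) (2 * Real.pi * (1 / 3)) := by
  have h := ternaryChar_two_pi_mul_pow_add e k 0
  have h1 (x : ℝ) : digitChar x 0 = 1 := by simp [digitChar]; ring
  simp only [zero_mul, add_zero, h1, Finset.prod_const_one, one_mul] at h
  rw [h, ternaryChar_eq_prod_mul _ 1]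
  simp only [Finset.range_one, Finset.prod_singleton, add_zero, zero_add, pow_one]
  congr 1
  have : Real.cos (2 * Real.pi * (1 / 3)) = -(1 / 2) := by
    rw [show 2 * Real.pi * (1 / 3) = Real.pi - Real.pi / 3 by ring, Real.cos_pi_sub,
      Real.cos_pi_div_three]
  rw [digitChar, this]
  ring

lemma ternaryChar_two_pi_mul_pow_le (e : ℕ → unitInterval) (k : ℕ) :
    ternaryChar e (2 * Real.pi * 3 ^ k) ≤ e k := by
  rw [ternaryChar_two_pi_mul_pow]
  exact mul_le_of_le_one_right (e k).2.1 (le_of_abs_le (abs_ternaryChar_le_one _ _))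

lemma le_ternaryChar_two_pi_mul_pow (e : ℕ → unitInterval) (k : ℕ) :
    (e k : ℝ) / 2 ≤ ternaryChar e (2 * Real.pi * 3 ^ k) := by
  rw [ternaryChar_two_pi_mul_pow, div_eq_mul_one_div]
  exact mul_le_mul_of_nonneg_left (half_le_ternaryChar _) (e k).2.1

lemma abs_ternaryChar_add_sub_mul_le (e : ℕ → unitInterval) (k : ℕ) (b : ℝ) :
    |ternaryChar e (2 * Real.pi * 3 ^ k + b) -
      ternaryChar e (2 * Real.pi * 3 ^ k) * ternaryChar e b| ≤ 2 * (|b| * (1 / 3) ^ k) := by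
  have h0 := ternaryChar_two_pi_mul_pow_add e k 0
  have h1 (x : ℝ) : digitChar x 0 = 1 := by simp [digitChar]; ring
  simp only [zero_mul, add_zero, h1, Finset.prod_const_one, one_mul] at h0
  rw [ternaryChar_two_pi_mul_pow_add, h0, ternaryChar_eq_prod_mul e k b]
  set H := ∏ i ∈ Finset.range k, digitChar (e i) (b * (1 / 3) ^ (i + 1)) with hH
  have hH1 : |H| ≤ 1 := abs_prod_digitChar_le_one e b k
  set T := ternaryChar (fun i ↦ e (k + i)) with hT
  set c := b * (1 / 3) ^ k with hc
  have hcabs : |c| = |b| * (1 / 3) ^ k := by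
    rw [hc, abs_mul, abs_of_pos (by positivity : (0 : ℝ) < (1 / 3) ^ k)]
  have h2 : |T (2 * Real.pi + c) - T (2 * Real.pi)| ≤ |c| := by
    simpa using abs_ternaryChar_sub_le_abs_sub (fun i ↦ e (k + i)) (2 * Real.pi + c) (2 * Real.pi)
  have h3 : |1 - T c| ≤ |c| := by
    simpa [ternaryChar_zero] using abs_ternaryChar_sub_le_abs_sub (fun i ↦ e (k + i)) 0 c
  have h4 : |T (2 * Real.pi)| ≤ 1 := abs_ternaryChar_le_one _ _
  rw [← hcabs]
  calc |H * T (2 * Real.pi + c) - T (2 * Real.pi) * (H * T c)|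
      = |H| * |(T (2 * Real.pi + c) - T (2 * Real.pi)) + T (2 * Real.pi) * (1 - T c)| := by
        rw [← abs_mul]; ring_nf
    _ ≤ 1 * (|c| + 1 * |c|) := by
        gcongr
        refine (abs_add_le _ _).trans ?_
        rw [abs_mul]
        gcongr
    _ = 2 * |c| := by ring

lemma mutuallySingular_of_forall_exists_le {Ω : Type*} {mΩ : MeasurableSpace Ω} {ν ρ : Measure Ω}
    (h : ∀ δ : ENNReal, 0 < δ → ∃ s, ν s ≤ δ ∧ ρ sᶜ ≤ δ) : ν.MutuallySingular ρ := by
  refine Measure.mutuallySingular_of_disjoint (disjoint_iff_inf_le.2 ?_)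
  refine (Measure.measure_univ_eq_zero.1 ?_).le
  refine le_antisymm (ENNReal.le_of_forall_pos_le_add fun δ hδ _ ↦ ?_) zero_le
  obtain ⟨s, hs, hs'⟩ := h (δ / 2) (ENNReal.half_pos (by exact_mod_cast hδ.ne'))
  calc (ν ⊓ ρ) Set.univ ≤ (ν ⊓ ρ) s + (ν ⊓ ρ) sᶜ := by
        rw [← Set.union_compl_self s]
        exact measure_union_le _ _
    _ ≤ ν s + ρ sᶜ :=
        add_le_add (Measure.le_iff'.1 inf_le_left s) (Measure.le_iff'.1 inf_le_right sᶜ)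
    _ ≤ δ / 2 + δ / 2 := add_le_add hs hs'
    _ = 0 + δ := by rw [ENNReal.add_halves, zero_add]

lemma sum_third_pow_dist_le (s : Finset ℕ) (j : ℕ) :
    ∑ k ∈ s, (1 / 3 : ℝ) ^ ((j - k) + (k - j)) ≤ 3 := by
  obtain ⟨K, hK⟩ := s.exists_nat_subset_range
  have hgeom (N : ℕ) : ∑ i ∈ Finset.range N, (1 / 3 : ℝ) ^ i ≤ 3 / 2 := by
    rw [geom_sum_eq (by norm_num),
      show ((1 / 3 : ℝ) ^ N - 1) / (1 / 3 - 1) = 3 / 2 - 3 / 2 * (1 / 3) ^ N by ring]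
    have : (0 : ℝ) ≤ (1 / 3) ^ N := by positivity
    linarith
  have hle : ∑ k ∈ Finset.range j, (1 / 3 : ℝ) ^ ((j - k) + (k - j)) ≤ 3 / 2 := by
    rw [← Finset.sum_range_reflect]
    refine (Finset.sum_le_sum fun k hk ↦ ?_).trans (hgeom j)
    rw [Finset.mem_range] at hk
    exact pow_le_pow_of_le_one (by norm_num) (by norm_num) (by omega)
  have hge : ∑ k ∈ Finset.range K, (1 / 3 : ℝ) ^ ((j - (j + k)) + (j + k - j)) ≤ 3 / 2 := by
    refine (Finset.sum_congr rfl fun k _ ↦ ?_).trans_le (hgeom K)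
    congr 1
    omega
  calc _ ≤ ∑ k ∈ Finset.range (j + K), (1 / 3 : ℝ) ^ ((j - k) + (k - j)) :=
        Finset.sum_le_sum_of_subset_of_nonneg
          (hK.trans (Finset.range_subset_range.2 (by omega))) fun _ _ _ ↦ by positivity
    _ ≤ 3 := by
        rw [Finset.sum_range_add]
        linarith

lemma charFun_convPowR (μ : Measure ℝ) [IsProbabilityMeasure μ] (n : ℕ) :
    IsProbabilityMeasure (convPowR μ n) ∧ ∀ t, charFun (convPowR μ n) t = charFun μ t ^ n := by
  induction n with
  | zero =>
    refine ⟨inferInstanceAs (IsProbabilityMeasure (Measure.dirac (0 : ℝ))), fun t ↦ ?_⟩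
    rw [convPowR, charFun_apply_real, integral_dirac]
    simp
  | succ n ih =>
    have := ih.1
    refine ⟨inferInstanceAs (IsProbabilityMeasure (μ.conv (convPowR μ n))), fun t ↦ ?_⟩
    rw [convPowR, charFun_conv, ih.2, pow_succ']

lemma integrable_cos_mul (ν : Measure ℝ) [IsProbabilityMeasure ν] (a : ℝ) :
    Integrable (fun x ↦ Real.cos (a * x)) ν :=
  Integrable.of_bound (C := 1) (by fun_prop)
    (ae_of_all _ fun x ↦ by simpa using Real.abs_cos_le_one (a * x))

lemma integral_cos_mul (ν : Measure ℝ) [IsProbabilityMeasure ν] (a : ℝ) :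
    ∫ x, Real.cos (a * x) ∂ν = (charFun ν a).re := by
  have h : Integrable (fun x : ℝ ↦ Complex.exp (a * x * Complex.I)) ν := by
    refine Integrable.of_bound (C := 1) (by fun_prop) (ae_of_all _ fun x ↦ ?_)
    rw [← Complex.ofReal_mul, Complex.norm_exp_ofReal_mul_I]
  rw [charFun_apply_real, ← RCLike.re_eq_complex_re, ← integral_re h]
  refine integral_congr_ae (ae_of_all _ fun x ↦ ?_)
  simp only [RCLike.re_eq_complex_re]
  rw [← Complex.ofReal_mul, Complex.exp_ofReal_mul_I_re]

lemma abs_pow_sub_pow_le_mul_abs_sub {a b : ℝ} (ha : |a| ≤ 1) (hb : |b| ≤ 1) (m : ℕ) :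
    |a ^ m - b ^ m| ≤ m * |a - b| := by
  simpa using abs_prod_sub_prod_le (Finset.range m) (fun _ ↦ a) (fun _ ↦ b) (fun _ ↦ ha) fun _ ↦ hb

lemma abs_ternaryChar_pow_add_sub_mul_le (e : ℕ → unitInterval) (m j k : ℕ) (hjk : j < k) (b : ℝ)
    (hb : b = 2 * Real.pi * 3 ^ j ∨ b = -(2 * Real.pi * 3 ^ j)) :
    |ternaryChar e (2 * Real.pi * 3 ^ k + b) ^ m -
      ternaryChar e (2 * Real.pi * 3 ^ j) ^ m * ternaryChar e (2 * Real.pi * 3 ^ k) ^ m| ≤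
      13 * m * (1 / 3) ^ ((j - k) + (k - j)) := by
  have hpos : 0 < 2 * Real.pi * 3 ^ j := by positivity
  have hF : ternaryChar e b = ternaryChar e (2 * Real.pi * 3 ^ j) := by
    rcases hb with rfl | rfl
    · rfl
    · rw [ternaryChar_neg]
  have hbabs : |b| = 2 * Real.pi * 3 ^ j := by
    rcases hb with rfl | rfl
    · exact abs_of_pos hpos
    · rw [abs_neg, abs_of_pos hpos]
  have h := abs_ternaryChar_add_sub_mul_le e k b
  rw [hbabs, hF] at h
  obtain ⟨d, rfl⟩ := Nat.exists_eq_add_of_lt hjk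
  rw [← mul_pow]
  refine (abs_pow_sub_pow_le_mul_abs_sub (abs_ternaryChar_le_one _ _) ?_ m).trans ?_
  · rw [abs_mul]
    exact mul_le_one₀ (abs_ternaryChar_le_one _ _) (abs_nonneg _) (abs_ternaryChar_le_one _ _)
  · rw [show (j - (j + d + 1)) + (j + d + 1 - j) = d + 1 by omega]
    rw [mul_comm (ternaryChar e (2 * Real.pi * 3 ^ j))]
    calc _ ≤ (m : ℝ) * (2 * (2 * Real.pi * 3 ^ j * (1 / 3) ^ (j + d + 1))) := by gcongr
      _ = m * (4 * Real.pi * (1 / 3) ^ (d + 1)) := by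
        have : (3 : ℝ) ^ j * (1 / 3) ^ j = 1 := by
          rw [← mul_pow]
          norm_num
        rw [add_assoc, pow_add _ j]
        linear_combination (m * 4 * Real.pi * (1 / 3) ^ (d + 1)) * this
      _ ≤ m * (13 * (1 / 3) ^ (d + 1)) := by
        gcongr
        linarith [Real.pi_lt_d2]
      _ = _ := by ring

/-- The covariance of `x ↦ cos (2π 3ʲ x)` and `x ↦ cos (2π 3ᵏ x)` under a convolution power of
`ternaryLaw e` decays exponentially in the distance of `j` and `k`. -/
lemma abs_integral_cos_sub_mul_cos_sub_le (e : ℕ → unitInterval) (m j k : ℕ) (hm : 0 < m) :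
    |∫ x, (Real.cos (2 * Real.pi * 3 ^ j * x) - ternaryChar e (2 * Real.pi * 3 ^ j) ^ m) *
      (Real.cos (2 * Real.pi * 3 ^ k * x) - ternaryChar e (2 * Real.pi * 3 ^ k) ^ m)
        ∂(convPowR (ternaryLaw e) m)| ≤ 13 * m * (1 / 3) ^ ((j - k) + (k - j)) := by
  obtain ⟨_, hchar⟩ := charFun_convPowR (ternaryLaw e) m
  have hcos (a : ℝ) : ∫ x, Real.cos (a * x) ∂(convPowR (ternaryLaw e) m) = ternaryChar e a ^ m := by
    rw [integral_cos_mul, hchar, charFun_ternaryLaw]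
    norm_cast
  set ν := convPowR (ternaryLaw e) m
  have key (a b : ℝ) : ∫ x, (Real.cos (a * x) - ternaryChar e a ^ m) *
      (Real.cos (b * x) - ternaryChar e b ^ m) ∂ν =
      (ternaryChar e (b + a) ^ m + ternaryChar e (b + -a) ^ m) / 2 -
        ternaryChar e a ^ m * ternaryChar e b ^ m := by
    have : ∀ x, (Real.cos (a * x) - ternaryChar e a ^ m) *
      (Real.cos (b * x) - ternaryChar e b ^ m) =
      (Real.cos ((b + a) * x) / 2 + Real.cos ((b + -a) * x) / 2) -
        ternaryChar e b ^ m * Real.cos (a * x) - ternaryChar e a ^ m * Real.cos (b * x) +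
        ternaryChar e a ^ m * ternaryChar e b ^ m := by
      intro x
      rw [add_mul, add_mul, Real.cos_add, Real.cos_add, neg_mul, Real.cos_neg, Real.sin_neg]
      ring
    have i1 := ((integrable_cos_mul ν (b + a)).div_const 2)
    have i2 := ((integrable_cos_mul ν (b + -a)).div_const 2)
    have i3 := ((integrable_cos_mul ν a).const_mul (ternaryChar e b ^ m))
    have i4 := ((integrable_cos_mul ν b).const_mul (ternaryChar e a ^ m))
    have i12 : Integrable
        (fun x ↦ Real.cos ((b + a) * x) / 2 + Real.cos ((b + -a) * x) / 2) ν := i1.add i2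
    have i123 : Integrable (fun x ↦ Real.cos ((b + a) * x) / 2 + Real.cos ((b + -a) * x) / 2 -
        ternaryChar e b ^ m * Real.cos (a * x)) ν := i12.sub i3
    have i1234 : Integrable (fun x ↦ Real.cos ((b + a) * x) / 2 + Real.cos ((b + -a) * x) / 2 -
        ternaryChar e b ^ m * Real.cos (a * x) - ternaryChar e a ^ m * Real.cos (b * x)) ν :=
      i123.sub i4
    simp_rw [this]
    rw [integral_add i1234 (integrable_const _), integral_sub i123 i4, integral_sub i12 i3,
      integral_add i1 i2,
      integral_div, integral_div, integral_const_mul, integral_const_mul, hcos, hcos, hcos, hcos]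
    simp
    ring
  wlog hjk : j ≤ k generalizing j k
  · have := this k j (by omega)
    rw [add_comm (j - k)]
    simpa only [mul_comm] using this
  rw [key]
  rcases hjk.eq_or_lt with rfl | hlt
  · have h1 (t : ℝ) : |ternaryChar e t ^ m| ≤ 1 := by
      rw [abs_pow]
      exact pow_le_one₀ (abs_nonneg _) (abs_ternaryChar_le_one _ _)
    set a := 2 * Real.pi * 3 ^ j
    have h2 := abs_le.1 (h1 (a + a))
    have h3 := abs_le.1 (h1 (a + -a))
    have h4 := abs_le.1 (h1 a)
    have hm1 : (1 : ℝ) ≤ m := by exact_mod_cast hm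
    rw [Nat.sub_self, add_zero, pow_zero, mul_one, abs_le]
    constructor <;> nlinarith
  · have h1 := abs_le.1 (abs_ternaryChar_pow_add_sub_mul_le e m j k hlt _ (Or.inl rfl))
    have h2 := abs_le.1 (abs_ternaryChar_pow_add_sub_mul_le e m j k hlt _ (Or.inr rfl))
    rw [abs_le]
    constructor <;> linarith

lemma convPowR_ternaryLaw_le (e : ℕ → unitInterval) (m : ℕ) (hm : 0 < m) (B : Finset ℕ) {d : ℝ}
    (hd : 0 < d) :
    convPowR (ternaryLaw e) m {x | d ≤ |∑ k ∈ B, (Real.cos (2 * Real.pi * 3 ^ k * x) -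
      ternaryChar e (2 * Real.pi * 3 ^ k) ^ m)|} ≤ ENNReal.ofReal (39 * m * B.card / d ^ 2) := by
  obtain ⟨_, -⟩ := charFun_convPowR (ternaryLaw e) m
  set ν := convPowR (ternaryLaw e) m
  set g : ℕ → ℝ → ℝ := fun k x ↦
    Real.cos (2 * Real.pi * 3 ^ k * x) - ternaryChar e (2 * Real.pi * 3 ^ k) ^ m with hg
  have hgm (k : ℕ) : Continuous (g k) := by fun_prop
  have hgb (k : ℕ) (x : ℝ) : ‖g k x‖ ≤ 2 := by
    have h1 : |ternaryChar e (2 * Real.pi * 3 ^ k) ^ m| ≤ 1 := by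
      rw [abs_pow]
      exact pow_le_one₀ (abs_nonneg _) (abs_ternaryChar_le_one _ _)
    have h2 := Real.abs_cos_le_one (2 * Real.pi * 3 ^ k * x)
    calc _ ≤ _ := norm_sub_le _ _
      _ ≤ 2 := by
        simp only [Real.norm_eq_abs]
        linarith
  have hint (j k : ℕ) : Integrable (fun x ↦ g j x * g k x) ν := by
    refine Integrable.of_bound (C := 4) ((hgm j).mul (hgm k)).aestronglyMeasurable
      (ae_of_all _ fun x ↦ ?_)
    rw [norm_mul]
    nlinarith [hgb j x, hgb k x, norm_nonneg (g j x), norm_nonneg (g k x)]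
  have hsq : ∀ x, (∑ k ∈ B, g k x) ^ 2 = ∑ j ∈ B, ∑ k ∈ B, g j x * g k x := fun x ↦ by
    rw [sq, Finset.sum_mul_sum]
  have hbound : ∫ x, (∑ k ∈ B, g k x) ^ 2 ∂ν ≤ 39 * m * B.card := by
    simp_rw [hsq]
    rw [integral_finsetSum _ fun j _ ↦ integrable_finsetSum _ fun k _ ↦ hint j k]
    calc ∑ j ∈ B, ∫ x, ∑ k ∈ B, g j x * g k x ∂ν ≤ ∑ j ∈ B, (13 * m * 3 : ℝ) := by
          refine Finset.sum_le_sum fun j _ ↦ ?_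
          rw [integral_finsetSum _ fun k _ ↦ hint j k]
          calc _ ≤ ∑ k ∈ B, 13 * m * (1 / 3 : ℝ) ^ ((j - k) + (k - j)) :=
                Finset.sum_le_sum fun k _ ↦
                  le_of_abs_le (abs_integral_cos_sub_mul_cos_sub_le e m j k hm)
            _ ≤ _ := by
                rw [← Finset.mul_sum]
                gcongr
                exact sum_third_pow_dist_le B j
      _ = _ := by
          rw [Finset.sum_const, nsmul_eq_mul]
          ring
  have hint2 : Integrable (fun x ↦ (∑ k ∈ B, g k x) ^ 2) ν := by
    simp_rw [hsq]
    exact integrable_finsetSum _ fun j _ ↦ integrable_finsetSum _ fun k _ ↦ hint j k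
  have hmarkov := mul_meas_ge_le_integral_of_nonneg (ae_of_all _ fun x ↦ sq_nonneg _) hint2 (d ^ 2)
  have hset : {x | d ≤ |∑ k ∈ B, g k x|} = {x | d ^ 2 ≤ (∑ k ∈ B, g k x) ^ 2} := by
    ext x
    rw [Set.mem_ofPred_eq, Set.mem_ofPred_eq, sq_le_sq, abs_of_pos hd]
  change ν {x | d ≤ |∑ k ∈ B, g k x|} ≤ _
  rw [hset, ← ofReal_measureReal]
  refine ENNReal.ofReal_le_ofReal ?_
  rw [le_div_iff₀ (by positivity), mul_comm]
  exact hmarkov.trans hbound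

lemma sum_ternaryChar_pow_sub_pow_ge (e : ℕ → unitInterval) (m n : ℕ) (hmn : m < n) (J : ℕ)
    (he : ∀ k ∈ Finset.Ico (2 ^ J) (2 ^ (J + 1)), (e k : ℝ) = 1 / (J + 2)) :
    2 ^ J * (1 / (2 * (J + 2) : ℝ)) ^ m / 2 ≤
      ∑ k ∈ Finset.Ico (2 ^ J) (2 ^ (J + 1)), (ternaryChar e (2 * Real.pi * 3 ^ k) ^ m -
        ternaryChar e (2 * Real.pi * 3 ^ k) ^ n) := by
  calc 2 ^ J * (1 / (2 * (J + 2) : ℝ)) ^ m / 2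
      = ∑ k ∈ Finset.Ico (2 ^ J) (2 ^ (J + 1)), (1 / (2 * (J + 2) : ℝ)) ^ m / 2 := by
        rw [Finset.sum_const, Nat.card_Ico, nsmul_eq_mul, show 2 ^ (J + 1) - 2 ^ J = 2 ^ J by
          rw [pow_succ]; omega]
        push_cast
        ring
    _ ≤ _ := by
        refine Finset.sum_le_sum fun k hk ↦ ?_
        have h1 := le_ternaryChar_two_pi_mul_pow e k
        have h2 := ternaryChar_two_pi_mul_pow_le e k
        rw [he k hk] at h1 h2
        set c := ternaryChar e (2 * Real.pi * 3 ^ k)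
        have h3 : (1 : ℝ) / (J + 2) ≤ 1 / 2 :=
          one_div_le_one_div_of_le (by norm_num) (by linarith [Nat.cast_nonneg (α := ℝ) J])
        have h4 : (1 : ℝ) / (2 * (J + 2)) ≤ c := by
          rwa [mul_comm, ← div_div]
        have h5 : 0 ≤ c := le_trans (by positivity) h4
        have h6 : (1 / (2 * (J + 2) : ℝ)) ^ m ≤ c ^ m := by gcongr
        have h7 : c ^ n ≤ c ^ (m + 1) := pow_le_pow_of_le_one h5 (by linarith) hmn
        have h8 : c ^ m * c ≤ c ^ m * (1 / 2) := by
          gcongr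
          linarith
        rw [pow_succ] at h7
        linarith

lemma mutuallySingular_convPowR_ternaryLaw (e : ℕ → unitInterval)
    (he : ∃ᶠ J : ℕ in atTop, ∀ k ∈ Finset.Ico (2 ^ J) (2 ^ (J + 1)), (e k : ℝ) = 1 / (J + 2))
    (m n : ℕ) (hm : 0 < m) (hmn : m < n) :
    (convPowR (ternaryLaw e) m).MutuallySingular (convPowR (ternaryLaw e) n) := by
  refine mutuallySingular_of_forall_exists_le fun δ hδ ↦ ?_
  have hlim : Tendsto (fun J : ℕ ↦
      ENNReal.ofReal (624 * n * 2 ^ (2 * m) * ((J + 2 : ℕ) ^ (2 * m) / 2 ^ J))) atTop (𝓝 0) := by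
    rw [← ENNReal.ofReal_zero]
    refine ENNReal.tendsto_ofReal ?_
    have h1 := (tendsto_pow_const_div_const_pow_of_one_lt (2 * m)
      (by norm_num : (1 : ℝ) < 2)).comp (tendsto_add_atTop_nat 2)
    have h2 := h1.const_mul (624 * n * 2 ^ (2 * m) * 4 : ℝ)
    rw [mul_zero] at h2
    refine h2.congr fun J ↦ ?_
    simp only [Function.comp]
    rw [pow_add 2 J 2]
    field_simp
    norm_num
  obtain ⟨J, heJ, hJ⟩ := (he.and_eventually (hlim.eventually (ge_mem_nhds hδ))).exists
  set B := Finset.Ico (2 ^ J) (2 ^ (J + 1)) with hB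
  have hcard : (B.card : ℝ) = 2 ^ J := by
    rw [hB, Nat.card_Ico, show 2 ^ (J + 1) - 2 ^ J = 2 ^ J by rw [pow_succ]; omega]
    norm_cast
  set d : ℝ := 2 ^ J * (1 / (2 * (J + 2) : ℝ)) ^ m / 4 with hd
  have hdpos : 0 < d := by positivity
  have hbound (l : ℕ) (hl : l ≤ n) : ENNReal.ofReal (39 * l * B.card / d ^ 2) ≤ δ := by
    refine le_trans (ENNReal.ofReal_le_ofReal ?_) hJ
    rw [hcard, hd]
    have hl' : (l : ℝ) ≤ n := by exact_mod_cast hl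
    calc 39 * l * 2 ^ J / (2 ^ J * (1 / (2 * (J + 2) : ℝ)) ^ m / 4) ^ 2
        = 624 * l * 2 ^ (2 * m) * ((J + 2 : ℕ) ^ (2 * m) / 2 ^ J) := by
          push_cast
          rw [one_div, inv_pow, mul_pow, mul_comm 2 m, pow_mul, pow_mul]
          field_simp
          ring
      _ ≤ _ := by gcongr
  refine ⟨_, (convPowR_ternaryLaw_le e m hm B hdpos).trans (hbound m hmn.le),
    (measure_mono fun x hx ↦ ?_).trans
      ((convPowR_ternaryLaw_le e n (hm.trans hmn) B hdpos).trans (hbound n le_rfl))⟩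
  rw [Set.mem_compl_iff, Set.mem_ofPred_eq, not_le] at hx
  have h1 := sum_ternaryChar_pow_sub_pow_ge e m n hmn J heJ
  rw [Set.mem_ofPred_eq]
  rw [Finset.sum_sub_distrib] at hx h1 ⊢
  refine le_trans ?_ (le_abs_self _)
  have h2 := (abs_lt.1 hx).1
  have h3 : 2 ^ J * (1 / (2 * (J + 2) : ℝ)) ^ m / 2 = 2 * d := by rw [hd]; ring
  linarith

/-- The sequence taking the value `1 / (j + 2)` on `[2 ^ j, 2 ^ (j + 1))` if `j ∈ A` and `0`
otherwise. -/
def dyadicSeq (A : Set ℕ) (k : ℕ) : unitInterval :=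
  ⟨A.indicator (fun j ↦ 1 / ((j : ℝ) + 2)) (Nat.log 2 k),
    Set.indicator_nonneg (fun j _ ↦ by positivity) _,
    Set.indicator_apply_le' (fun _ ↦ by
      rw [div_le_one (by positivity)]
      linarith [Nat.cast_nonneg (α := ℝ) (Nat.log 2 k)]) fun _ ↦ zero_le_one⟩

lemma coe_dyadicSeq (A : Set ℕ) {j k : ℕ} (hk : k ∈ Finset.Ico (2 ^ j) (2 ^ (j + 1))) (hj : j ∈ A) :
    (dyadicSeq A k : ℝ) = 1 / (j + 2) := by
  rw [Finset.mem_Ico] at hk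
  have : Nat.log 2 k = j := Nat.log_eq_of_pow_le_of_lt_pow hk.1 hk.2
  simp [dyadicSeq, this, hj]

lemma dyadicSeq_eq_zero {A : Set ℕ} {k : ℕ} (h : Nat.log 2 k ∉ A) : dyadicSeq A k = 0 :=
  Subtype.ext (by simp [dyadicSeq, h])

lemma tendsto_dyadicSeq (A : Set ℕ) : Tendsto (fun k ↦ (dyadicSeq A k : ℝ)) atTop (𝓝 0) := by
  have hlog : Tendsto (fun k ↦ Nat.log 2 k) atTop atTop :=
    tendsto_atTop.2 fun b ↦ (eventually_ge_atTop (2 ^ b)).mono fun k hk ↦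
      Nat.le_log_of_pow_le (by norm_num) hk
  have h1 : Tendsto (fun j : ℕ ↦ 1 / ((j : ℝ) + 2)) atTop (𝓝 0) := by
    have := (tendsto_one_div_add_atTop_nhds_zero_nat (𝕜 := ℝ)).comp (tendsto_add_atTop_nat 1)
    refine this.congr fun j ↦ ?_
    simp only [Function.comp]
    push_cast
    ring_nf
  refine squeeze_zero (fun k ↦ (dyadicSeq A k).2.1) (fun k ↦ ?_) (h1.comp hlog)
  simp only [dyadicSeq, Function.comp]
  exact Set.indicator_apply_le' (fun _ ↦ le_rfl) fun _ ↦ by positivity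

/-- An almost disjoint family of infinite sets of natural numbers indexed by `ℝ`. -/
def floorCodes (α : ℝ) : Set ℕ := Set.range fun n : ℕ ↦ Encodable.encode (n, ⌊α * n⌋)

lemma infinite_floorCodes (α : ℝ) : (floorCodes α).Infinite :=
  Set.infinite_range_of_injective fun _ _ h ↦ (Prod.ext_iff.1 (Encodable.encode_injective h)).1

lemma finite_floorCodes_inter {α β : ℝ} (h : α ≠ β) : (floorCodes α ∩ floorCodes β).Finite := by
  obtain ⟨N, hN⟩ := exists_nat_gt (1 / |α - β|)
  have hpos : 0 < |α - β| := abs_pos.2 (sub_ne_zero.2 h)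
  refine ((Set.finite_lt_nat N).image fun n : ℕ ↦ Encodable.encode (n, ⌊α * n⌋)).subset ?_
  rintro _ ⟨⟨n, rfl⟩, ⟨n', hn'⟩⟩
  obtain ⟨rfl, hfl⟩ := Prod.ext_iff.1 (Encodable.encode_injective hn')
  refine ⟨n', ?_, rfl⟩
  have h1 := Int.abs_sub_lt_one_of_floor_eq_floor hfl
  rw [← sub_mul, abs_mul, Nat.abs_cast, abs_sub_comm, mul_comm, ← lt_div_iff₀ hpos] at h1
  exact_mod_cast h1.trans hN

lemma injective_ternaryLaw_floorCodes :
    Function.Injective (fun α ↦ ternaryLaw (dyadicSeq (floorCodes α))) := by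
  intro α β h
  by_contra hne
  obtain ⟨j, hjα, hjβ⟩ : (floorCodes α \ floorCodes β).Nonempty := by
    rw [← Set.sdiff_inter_self_eq_sdiff, Set.inter_comm]
    exact ((infinite_floorCodes α).sdiff (finite_floorCodes_inter hne)).nonempty
  have hmem : 2 ^ j ∈ Finset.Ico (2 ^ j) (2 ^ (j + 1)) := by
    rw [Finset.mem_Ico]
    exact ⟨le_rfl, Nat.pow_lt_pow_succ (by norm_num)⟩
  have h1 := le_ternaryChar_two_pi_mul_pow (dyadicSeq (floorCodes α)) (2 ^ j)
  have h2 := ternaryChar_two_pi_mul_pow_le (dyadicSeq (floorCodes β)) (2 ^ j)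
  rw [coe_dyadicSeq _ hmem hjα] at h1
  rw [dyadicSeq_eq_zero (by rwa [Nat.log_pow (by norm_num)])] at h2
  have h3 : (0 : ℝ) < 1 / (j + 2) / 2 := by positivity
  have h4 : ternaryChar (dyadicSeq (floorCodes α)) = ternaryChar (dyadicSeq (floorCodes β)) := by
    ext t
    exact congrArg (fun μ ↦ (charFun μ t).re) h
  rw [h4] at h1
  exact absurd (h3.trans_le (h1.trans h2)) (lt_irrefl _)

lemma hasIndependentPowersR_ternaryLaw_floorCodes (α : ℝ) :
    HasIndependentPowersR (ternaryLaw (dyadicSeq (floorCodes α))) := by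
  have he : ∃ᶠ J : ℕ in atTop, ∀ k ∈ Finset.Ico (2 ^ J) (2 ^ (J + 1)),
      (dyadicSeq (floorCodes α) k : ℝ) = 1 / (J + 2) :=
    ((Nat.frequently_atTop_iff_infinite (p := (· ∈ floorCodes α))).2
      (infinite_floorCodes α)).mono fun J hJ k hk ↦ coe_dyadicSeq _ hk hJ
  intro m n hm hn hmn
  rcases hmn.lt_or_gt with h | h
  · exact mutuallySingular_convPowR_ternaryLaw _ he m n hm h
  · exact (mutuallySingular_convPowR_ternaryLaw _ he n m hn h).symm

lemma ternaryLaw_floorCodes_conv_absolutelyContinuous {α β : ℝ} (h : α ≠ β) :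
    (ternaryLaw (dyadicSeq (floorCodes α))).conv (ternaryLaw (dyadicSeq (floorCodes β))) ≪
      volume := by
  obtain ⟨M, hM⟩ := (finite_floorCodes_inter h).bddAbove
  refine ternaryLaw_conv_absolutelyContinuous _ _ (2 ^ (M + 1)) fun k hk ↦ ?_
  have hlog : M < Nat.log 2 k := Nat.le_log_of_pow_le (by norm_num) hk
  by_contra! hne
  refine hlog.not_ge (hM ⟨?_, ?_⟩) <;> by_contra hA
  · exact hne.1 (dyadicSeq_eq_zero hA)
  · exact hne.2 (dyadicSeq_eq_zero hA)

lemma FSR_ternaryLaw (e : ℕ → unitInterval) (t : ℝ) :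
    FSR (ternaryLaw e) t = (ternaryChar e t : ℂ) := by
  rw [← ternaryChar_neg, ← charFun_ternaryLaw, charFun_apply_real, FSR]
  simp

/-- `M₀(ℝ)` contains a family of continuum many Hermitian probability
measures with independent powers whose pairwise convolutions are absolutely continuous
with respect to Lebesgue measure (i.e. lie in `L¹(ℝ)`). -/
theorem exists_family_M0_real :
    ∃ μ : ℝ → Measure ℝ, Function.Injective μ ∧
      (∀ α, IsProbabilityMeasure (μ α)) ∧
      (∀ α, ∀ t : ℝ, (FSR (μ α) t).im = 0) ∧
      (∀ α, Tendsto (FSR (μ α)) (cocompact ℝ) (𝓝 0)) ∧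
      (∀ α, HasIndependentPowersR (μ α)) ∧
      (∀ α β, α ≠ β → (μ α).conv (μ β) ≪ MeasureTheory.volume) := by
  refine ⟨fun α ↦ ternaryLaw (dyadicSeq (floorCodes α)), injective_ternaryLaw_floorCodes,
    fun α ↦ inferInstance, fun α t ↦ ?_, fun α ↦ ?_, hasIndependentPowersR_ternaryLaw_floorCodes,
    fun α β ↦ ternaryLaw_floorCodes_conv_absolutelyContinuous⟩
  · rw [FSR_ternaryLaw, Complex.ofReal_im]
  · rw [funext (FSR_ternaryLaw _)]
    exact (Complex.continuous_ofReal.tendsto' 0 0 Complex.ofReal_zero).comp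
      (tendsto_ternaryChar_cocompact _ (tendsto_dyadicSeq _))
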